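/- arXiv:1711.09741 — 2 statements merged into one kernel-verified Lean document; each statement's English description precedes it below -/
import Mathlib

section
/- For p ∈ [0,1] and k ≥ 1 let p_k denote the probability that M ~ M(2^k,2^k,2^k;p) contains a Latin square, and let q(x) = 2x⁴ − x⁸. Then p_1 = q(p), and for every k ≥ 2 one has p_k ≥ q(p_{k−1}). -/
attribute [local instance] Classical.propDecidable

noncomputable section

/-- The number of ones in an `m × n × k` 0-1 array. -/
def numOnes {m n k : ℕ} (M : Fin m → Fin n → Fin k → Bool) : ℕ :=
  (Finset.univ.filter (fun x : Fin m × Fin n × Fin k => M x.1 x.2.1 x.2.2 = true)).card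

/-- An `m × n × k` 0-1 array is a Latin box if it has exactly `m * n` ones and
every line (fixing two coordinates, varying the third) has at most one `1`. -/
def IsLatinBox {m n k : ℕ} (M : Fin m → Fin n → Fin k → Bool) : Prop :=
  numOnes M = m * n ∧
  (∀ i j, (Finset.univ.filter (fun c => M i j c = true)).card ≤ 1) ∧
  (∀ i c, (Finset.univ.filter (fun j => M i j c = true)).card ≤ 1) ∧
  (∀ j c, (Finset.univ.filter (fun i => M i j c = true)).card ≤ 1)

/-- `M` contains (supports) a Latin box. -/
def ContainsLatinBox {m n k : ℕ} (M : Fin m → Fin n → Fin k → Bool) : Prop :=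
  ∃ L : Fin m → Fin n → Fin k → Bool, IsLatinBox L ∧ ∀ i j c, L i j c = true → M i j c = true

/-- The probability that a random `m × n × k` 0-1 array, whose entries are
independently `1` with probability `p`, satisfies the property `P`. -/
def arrProb (m n k : ℕ) (p : ℝ) (P : (Fin m → Fin n → Fin k → Bool) → Prop) : ℝ :=
  ∑ M : Fin m → Fin n → Fin k → Bool,
    if P M then ∏ i, ∏ j, ∏ c, (if M i j c = true then p else 1 - p) else 0

/-- The probability that a Bernoulli(`p`) variable takes the value `b`. -/
def bernoulliWeight (p : ℝ) (b : Bool) : ℝ :=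
  if b = true then p else 1 - p

/-- The probability of a single array under independent Bernoulli(`p`) entries. -/
def arrWeight {m n k : ℕ} (p : ℝ) (M : Fin m → Fin n → Fin k → Bool) : ℝ :=
  ∏ i, ∏ j, ∏ c, bernoulliWeight p (M i j c)

lemma arrProb_eq_sum_arrWeight (m n k : ℕ) (p : ℝ)
    (P : (Fin m → Fin n → Fin k → Bool) → Prop) :
    arrProb m n k p P = ∑ M, if P M then arrWeight p M else 0 := rfl

lemma arrWeight_nonneg {m n k : ℕ} {p : ℝ} (hp0 : 0 ≤ p) (hp1 : p ≤ 1)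
    (M : Fin m → Fin n → Fin k → Bool) : 0 ≤ arrWeight p M := by
  refine Finset.prod_nonneg fun i _ => Finset.prod_nonneg fun j _ =>
    Finset.prod_nonneg fun c _ => ?_
  unfold bernoulliWeight
  split_ifs <;> linarith

lemma sum_prod_apply {ι κ : Type*} [Fintype ι] [DecidableEq ι] [Fintype κ]
    (f : ι → κ → ℝ) : ∑ g : ι → κ, ∏ i, f i (g i) = ∏ i, ∑ x, f i x := by
  rw [Finset.prod_univ_sum, Fintype.piFinset_univ]

lemma sum_arrWeight (m n k : ℕ) (p : ℝ) :
    ∑ M : Fin m → Fin n → Fin k → Bool, arrWeight p M = 1 := by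
  unfold arrWeight
  rw [sum_prod_apply (fun _ (x : Fin n → Fin k → Bool) =>
    ∏ j, ∏ c, bernoulliWeight p (x j c))]
  refine Finset.prod_eq_one fun i _ => ?_
  rw [sum_prod_apply (fun _ (x : Fin k → Bool) => ∏ c, bernoulliWeight p (x c))]
  refine Finset.prod_eq_one fun j _ => ?_
  rw [sum_prod_apply (fun _ (x : Bool) => bernoulliWeight p x)]
  exact Finset.prod_eq_one fun c _ => by simp [bernoulliWeight]

lemma isLatinBox_iff {m n k : ℕ} (L : Fin m → Fin n → Fin k → Bool) :
    IsLatinBox L ↔ (∀ i j, ∃ c, L i j c = true) ∧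
      (∀ i j c c', L i j c = true → L i j c' = true → c = c') ∧
      (∀ i c j j', L i j c = true → L i j' c = true → j = j') ∧
      (∀ j c i i', L i j c = true → L i' j c = true → i = i') := by
  have hcount : numOnes L =
      ∑ i, ∑ j, (Finset.univ.filter (fun c => L i j c = true)).card := by
    simp only [numOnes, Finset.card_filter, Fintype.sum_prod_type]
  have hmn : m * n = ∑ _i : Fin m, ∑ _j : Fin n, 1 := by simp
  simp only [IsLatinBox, Finset.card_le_one, Finset.mem_filter, Finset.mem_univ, true_and]
  constructor
  · rintro ⟨hn, h1, h2, h3⟩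
    have hle : ∀ i j, (Finset.univ.filter (fun c => L i j c = true)).card ≤ 1 := by
      intro i j
      rw [Finset.card_le_one]
      simpa using h1 i j
    refine ⟨fun i j => ?_, fun i j c c' h h' => h1 i j c h c' h',
      fun i c j j' h h' => h2 i c j h j' h', fun j c i i' h h' => h3 j c i h i' h'⟩
    rw [hcount, hmn, Finset.sum_eq_sum_iff_of_le
      (fun i _ => Finset.sum_le_sum fun j _ => hle i j)] at hn
    have hi := hn i (Finset.mem_univ _)
    rw [Finset.sum_eq_sum_iff_of_le (fun j _ => hle i j)] at hi
    have hij := hi j (Finset.mem_univ _)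
    obtain ⟨c, hc⟩ := Finset.card_pos.1 (hij ▸ Nat.one_pos)
    exact ⟨c, by simpa using hc⟩
  · rintro ⟨h0, h1, h2, h3⟩
    refine ⟨?_, fun i j c h c' h' => h1 i j c c' h h',
      fun i c j h j' h' => h2 i c j j' h h', fun j c i h i' h' => h3 j c i i' h h'⟩
    rw [hcount, hmn]
    refine Finset.sum_congr rfl fun i _ => Finset.sum_congr rfl fun j _ => ?_
    obtain ⟨c, hc⟩ := h0 i j
    rw [Finset.card_eq_one]
    refine ⟨c, Finset.ext fun c' => ?_⟩
    simp only [Finset.mem_filter, Finset.mem_univ, true_and, Finset.mem_singleton]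
    exact ⟨fun h => h1 i j c' c h hc, fun h => h ▸ hc⟩

/-- Cutting an array of order `N'` into eight blocks of order `N`, along an identification of
`Fin N'` with two copies of `Fin N`. -/
def blockEquiv {N N' : ℕ} (e : Fin 2 × Fin N ≃ Fin N') :
    (Fin N' → Fin N' → Fin N' → Bool) ≃
      (Fin 2 × Fin 2 × Fin 2 → Fin N → Fin N → Fin N → Bool) where
  toFun M t i j c := M (e (t.1, i)) (e (t.2.1, j)) (e (t.2.2, c))
  invFun B I J K := B ((e.symm I).1, (e.symm J).1, (e.symm K).1)
    (e.symm I).2 (e.symm J).2 (e.symm K).2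
  left_inv M := by ext; simp
  right_inv B := by ext; simp

lemma arrWeight_eq_prod_blocks {N N' : ℕ} (e : Fin 2 × Fin N ≃ Fin N') (p : ℝ)
    (M : Fin N' → Fin N' → Fin N' → Bool) :
    arrWeight p M = ∏ t, arrWeight p (blockEquiv e M t) := by
  simp only [arrWeight, blockEquiv, Equiv.coe_fn_mk, Fintype.prod_prod_type]
  simp only [← e.prod_comp, Fintype.prod_prod_type, Fin.prod_univ_two,
    Finset.prod_mul_distrib]

/-- The blocks lying on the order-2 Latin square `{(a, b, c) | a + b + c = s}` all contain
Latin squares. -/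
def BlocksContain {N : ℕ} (B : Fin 2 × Fin 2 × Fin 2 → Fin N → Fin N → Fin N → Bool)
    (s : Fin 2) : Prop :=
  ∀ t, t.1 + t.2.1 + t.2.2 = s → ContainsLatinBox (B t)

lemma containsLatinBox_of_blocksContain {N N' : ℕ} (e : Fin 2 × Fin N ≃ Fin N')
    (M : Fin N' → Fin N' → Fin N' → Bool) (s : Fin 2)
    (h : BlocksContain (blockEquiv e M) s) : ContainsLatinBox M := by
  choose! L hL hLM using h
  simp only [isLatinBox_iff] at hL
  set L' : Fin 2 × Fin 2 × Fin 2 → Fin N → Fin N → Fin N → Bool :=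
    fun t i j c => decide (t.1 + t.2.1 + t.2.2 = s ∧ L t i j c = true) with hL'
  refine ⟨(blockEquiv e).symm L', ?_, ?_⟩
  · rw [isLatinBox_iff]
    have key : ∀ I J K, (blockEquiv e).symm L' I J K = true ↔
        ((e.symm I).1 + (e.symm J).1 + (e.symm K).1 = s ∧
          L ((e.symm I).1, (e.symm J).1, (e.symm K).1)
            (e.symm I).2 (e.symm J).2 (e.symm K).2 = true) := by
      intro I J K
      simp [blockEquiv, hL']
    simp only [key, e.symm.forall_congr_left, e.symm.exists_congr_left, Equiv.symm_symm,
      Equiv.symm_apply_apply, Prod.forall, Prod.exists, e.apply_eq_iff_eq, Prod.mk.injEq]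
    refine ⟨?_, ?_, ?_, ?_⟩
    · intro a i b j
      have hs : a + b + (s - a - b) = s := by abel
      obtain ⟨c, hc⟩ := (hL (a, b, s - a - b) hs).1 i j
      exact ⟨_, c, hs, hc⟩
    · rintro a i b j c k c' k' ⟨hs, h⟩ ⟨hs', h'⟩
      obtain rfl : c = c' := add_left_cancel (hs.trans hs'.symm)
      exact ⟨rfl, (hL _ hs).2.1 _ _ _ _ h h'⟩
    · rintro a i c k b j b' j' ⟨hs, h⟩ ⟨hs', h'⟩
      obtain rfl : b = b' := add_left_cancel (add_right_cancel (hs.trans hs'.symm))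
      exact ⟨rfl, (hL _ hs).2.2.1 _ _ _ _ h h'⟩
    · rintro b j c k a i a' i' ⟨hs, h⟩ ⟨hs', h'⟩
      obtain rfl : a = a' :=
        add_right_cancel (add_right_cancel (hs.trans hs'.symm))
      exact ⟨rfl, (hL _ hs).2.2.2 _ _ _ _ h h'⟩
  · intro I J K hIJK
    have hIJK' : (e.symm I).1 + (e.symm J).1 + (e.symm K).1 = s ∧
          L ((e.symm I).1, (e.symm J).1, (e.symm K).1)
            (e.symm I).2 (e.symm J).2 (e.symm K).2 = true := by
      simpa [blockEquiv, hL'] using hIJK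
    simpa [blockEquiv] using hLM _ hIJK'.1 _ _ _ hIJK'.2

lemma containsLatinBox_one_iff (M : Fin 1 → Fin 1 → Fin 1 → Bool) :
    ContainsLatinBox M ↔ M 0 0 0 = true := by
  constructor
  · rintro ⟨L, hL, hLM⟩
    obtain ⟨c, hc⟩ := ((isLatinBox_iff L).1 hL).1 0 0
    rw [Subsingleton.elim c 0] at hc
    exact hLM _ _ _ hc
  · intro h
    refine ⟨fun _ _ _ => true, (isLatinBox_iff _).2 ?_, fun i j c _ => ?_⟩
    · exact ⟨fun _ _ => ⟨0, rfl⟩, fun _ _ _ _ _ _ => Subsingleton.elim _ _,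
        fun _ _ _ _ _ _ => Subsingleton.elim _ _, fun _ _ _ _ _ _ => Subsingleton.elim _ _⟩
    · rwa [Subsingleton.elim i 0, Subsingleton.elim j 0, Subsingleton.elim c 0]

lemma arrProb_one (p : ℝ) : arrProb 1 1 1 p ContainsLatinBox = p := by
  simp only [arrProb, containsLatinBox_one_iff]
  rw [← (Equiv.funUnique (Fin 1) (Fin 1 → Fin 1 → Bool)).symm.sum_comp,
    ← (Equiv.funUnique (Fin 1) (Fin 1 → Bool)).symm.sum_comp,
    ← (Equiv.funUnique (Fin 1) Bool).symm.sum_comp]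
  simp

lemma binary_latin_eq_add (f : Fin 2 → Fin 2 → Fin 2)
    (h1 : ∀ a b b', f a b = f a b' → b = b') (h2 : ∀ b a a', f a b = f a' b → a = a')
    (a b c : Fin 2) (h : a + b + c = f 0 0) : f a b = c := by
  have h01 : f 0 1 ≠ f 0 0 := fun h => absurd (h1 _ _ _ h) (by decide)
  have h10 : f 1 0 ≠ f 0 0 := fun h => absurd (h2 _ _ _ h) (by decide)
  have h11 : f 1 1 ≠ f 1 0 := fun h => absurd (h1 _ _ _ h) (by decide)
  fin_cases a <;> fin_cases b <;> fin_cases c <;> simp at h ⊢ <;> omega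

lemma blocksContain_of_containsLatinBox {N' : ℕ} (e : Fin 2 × Fin 1 ≃ Fin N')
    (M : Fin N' → Fin N' → Fin N' → Bool) (h : ContainsLatinBox M) :
    BlocksContain (blockEquiv e M) 0 ∨ BlocksContain (blockEquiv e M) 1 := by
  obtain ⟨L, hL, hLM⟩ := h
  obtain ⟨h0, h1, h2, h3⟩ := (isLatinBox_iff L).1 hL
  have hex : ∀ a b : Fin 2, ∃ c : Fin 2, L (e (a, 0)) (e (b, 0)) (e (c, 0)) = true := by
    intro a b
    obtain ⟨K, hK⟩ := h0 (e (a, 0)) (e (b, 0))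
    obtain ⟨⟨c, z⟩, rfl⟩ := e.surjective K
    rw [Subsingleton.elim z 0] at hK
    exact ⟨c, hK⟩
  choose f hf using hex
  have hfs : ∃ s, BlocksContain (blockEquiv e M) s := by
    refine ⟨f 0 0, ?_⟩
    rintro ⟨a, b, c⟩ habc
    rw [containsLatinBox_one_iff]
    have hfc : f a b = c := by
      refine binary_latin_eq_add f (fun a b b' h => ?_) (fun b a a' h => ?_) a b c habc
      · have := h2 _ _ _ _ (hf a b) (h ▸ hf a b')
        simpa using this
      · have := h3 _ _ _ _ (hf a b) (h ▸ hf a' b)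
        simpa using this
    exact hLM _ _ _ (hfc ▸ hf a b)
  obtain ⟨s, hs⟩ := hfs
  fin_cases s
  · exact Or.inl hs
  · exact Or.inr hs

lemma sum_blocks_forall {N : ℕ} (p : ℝ) (S : Finset (Fin 2 × Fin 2 × Fin 2)) :
    ∑ B : Fin 2 × Fin 2 × Fin 2 → Fin N → Fin N → Fin N → Bool,
      (if ∀ t ∈ S, ContainsLatinBox (B t) then ∏ t, arrWeight p (B t) else 0) =
      arrProb N N N p ContainsLatinBox ^ S.card := by
  have h : ∀ B : Fin 2 × Fin 2 × Fin 2 → Fin N → Fin N → Fin N → Bool,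
      (if ∀ t ∈ S, ContainsLatinBox (B t) then ∏ t, arrWeight p (B t) else 0) =
      ∏ t, (if t ∈ S → ContainsLatinBox (B t) then arrWeight p (B t) else 0) := by
    intro B
    split_ifs with hB
    · exact Finset.prod_congr rfl fun t _ => (if_pos (hB t)).symm
    · push Not at hB
      obtain ⟨t, htS, ht⟩ := hB
      exact (Finset.prod_eq_zero (Finset.mem_univ t) (if_neg fun hc => ht (hc htS))).symm
  simp only [h]
  rw [sum_prod_apply (fun t (x : Fin N → Fin N → Fin N → Bool) =>
    if t ∈ S → ContainsLatinBox x then arrWeight p x else 0)]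
  have hf : ∀ t, (∑ x : Fin N → Fin N → Fin N → Bool,
      if t ∈ S → ContainsLatinBox x then arrWeight p x else 0) =
      if t ∈ S then arrProb N N N p ContainsLatinBox else 1 := by
    intro t
    by_cases ht : t ∈ S
    · simp [ht, arrProb_eq_sum_arrWeight]
    · simp [ht, sum_arrWeight]
  simp only [hf, Finset.prod_ite_mem, Finset.univ_inter, Finset.prod_const]

lemma arrProb_blocksContain {N N' : ℕ} (e : Fin 2 × Fin N ≃ Fin N') (p : ℝ) :
    arrProb N' N' N' p (fun M => BlocksContain (blockEquiv e M) 0 ∨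
      BlocksContain (blockEquiv e M) 1) =
    2 * arrProb N N N p ContainsLatinBox ^ 4 - arrProb N N N p ContainsLatinBox ^ 8 := by
  let S (s : Fin 2) : Finset (Fin 2 × Fin 2 × Fin 2) := {t | t.1 + t.2.1 + t.2.2 = s}
  have hS0 : (S 0).card = 4 := by 
    simp only [S, Finset.card_filter, Fintype.sum_prod_type, Fin.sum_univ_two]
    simp
  have hS1 : (S 1).card = 4 := by 
    simp only [S, Finset.card_filter, Fintype.sum_prod_type, Fin.sum_univ_two]
    simp
  have hU : (Finset.univ : Finset (Fin 2 × Fin 2 × Fin 2)).card = 8 := by simp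
  have hsum : arrProb N' N' N' p (fun M => BlocksContain (blockEquiv e M) 0 ∨
      BlocksContain (blockEquiv e M) 1) =
      ∑ B : Fin 2 × Fin 2 × Fin 2 → Fin N → Fin N → Fin N → Bool,
        if BlocksContain B 0 ∨ BlocksContain B 1 then ∏ t, arrWeight p (B t) else 0 := by
    rw [arrProb_eq_sum_arrWeight, ← (blockEquiv e).sum_comp]
    refine Finset.sum_congr rfl fun M _ => ?_
    rw [← arrWeight_eq_prod_blocks e p M]
    congr
  have h0 := sum_blocks_forall (N := N) p (S 0)
  have h1 := sum_blocks_forall (N := N) p (S 1)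
  have h01 := sum_blocks_forall (N := N) p Finset.univ
  rw [hS0] at h0
  rw [hS1] at h1
  rw [hU] at h01
  rw [hsum, two_mul]
  nth_rw 1 [← h0]
  rw [← h1, ← h01, ← Finset.sum_add_distrib, ← Finset.sum_sub_distrib]
  refine Finset.sum_congr rfl fun B _ => ?_
  have hB : ∀ s, (∀ t ∈ S s, ContainsLatinBox (B t)) ↔ BlocksContain B s := by
    intro s
    simp [S, BlocksContain]
  have hBU : (∀ t ∈ (Finset.univ : Finset (Fin 2 × Fin 2 × Fin 2)), ContainsLatinBox (B t)) ↔
      BlocksContain B 0 ∧ BlocksContain B 1 := by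
    refine ⟨fun h => ⟨fun t _ => h t (Finset.mem_univ t), fun t _ => h t (Finset.mem_univ t)⟩,
      fun h t _ => ?_⟩
    rcases Fin.exists_fin_two.1 ⟨t.1 + t.2.1 + t.2.2, rfl⟩ with ht | ht
    · exact h.1 t ht
    · exact h.2 t ht
  simp only [hB, hBU]
  by_cases h0 : BlocksContain B 0 <;> by_cases h1 : BlocksContain B 1 <;> simp [h0, h1]

lemma le_arrProb_double {N N' : ℕ} (e : Fin 2 × Fin N ≃ Fin N') {p : ℝ} (hp0 : 0 ≤ p)
    (hp1 : p ≤ 1) :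
    2 * arrProb N N N p ContainsLatinBox ^ 4 - arrProb N N N p ContainsLatinBox ^ 8 ≤
      arrProb N' N' N' p ContainsLatinBox := by
  rw [← arrProb_blocksContain e, arrProb_eq_sum_arrWeight, arrProb_eq_sum_arrWeight]
  refine Finset.sum_le_sum fun M _ => ?_
  have hw : 0 ≤ arrWeight p M := arrWeight_nonneg hp0 hp1 M
  by_cases h : BlocksContain (blockEquiv e M) 0 ∨ BlocksContain (blockEquiv e M) 1
  · rw [if_pos h, if_pos (h.elim (containsLatinBox_of_blocksContain e M 0)
      (containsLatinBox_of_blocksContain e M 1))]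
  · rw [if_neg h]
    split_ifs
    exacts [hw, le_rfl]

lemma arrProb_two_eq {N' : ℕ} (e : Fin 2 × Fin 1 ≃ Fin N') (p : ℝ) :
    arrProb N' N' N' p ContainsLatinBox = 2 * p ^ 4 - p ^ 8 := by
  have h := arrProb_blocksContain e p
  rw [arrProb_one] at h
  rw [← h]
  congr 1
  funext M
  exact propext ⟨blocksContain_of_containsLatinBox e M, fun h =>
    h.elim (containsLatinBox_of_blocksContain e M 0) (containsLatinBox_of_blocksContain e M 1)⟩

/-- Let `p_k` be the probability that a random `2^k × 2^k × 2^k` 0-1 array with i.i.d.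
Bernoulli(p) entries contains a Latin square, and `q(x) = 2x⁴ − x⁸`. Then `p_1 = q(p)` and
for every `k ≥ 2`, `p_k ≥ q(p_{k-1})`. -/
theorem stmt2 (p : ℝ) (hp0 : 0 ≤ p) (hp1 : p ≤ 1) :
    arrProb (2 ^ 1) (2 ^ 1) (2 ^ 1) p ContainsLatinBox = 2 * p ^ 4 - p ^ 8 ∧
    ∀ k : ℕ, 2 ≤ k →
      2 * (arrProb (2 ^ (k - 1)) (2 ^ (k - 1)) (2 ^ (k - 1)) p ContainsLatinBox) ^ 4
          - (arrProb (2 ^ (k - 1)) (2 ^ (k - 1)) (2 ^ (k - 1)) p ContainsLatinBox) ^ 8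
        ≤ arrProb (2 ^ k) (2 ^ k) (2 ^ k) p ContainsLatinBox := by
  refine ⟨arrProb_two_eq finProdFinEquiv p, fun k hk => ?_⟩
  have hpow : 2 * 2 ^ (k - 1) = 2 ^ k := by
    rw [← pow_succ', Nat.sub_add_cancel (by omega)]
  exact le_arrProb_double (finProdFinEquiv.trans (finCongr hpow)) hp0 hp1


end
end

section
/- Fix ε ∈ (0,1) and set m = ⌊(1−ε)n⌋. If p = p(n) ≤ log(n)/(2n), then with probability tending to 1 as n → ∞, the array M ~ M(m,n,n;p) has a line of the form M(i,j,·) consisting entirely of zeros (for some i ∈ [m], j ∈ [n]); consequently, w.h.p. M does not contain a Latin box. -/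
attribute [local instance] Classical.propDecidable

noncomputable section

/-- Product weights factor over the lines `M(i,j,·)`. -/
theorem sum_prod_lines (m n k : ℕ) (f : (Fin k → Bool) → ℝ) :
    ∑ M : Fin m → Fin n → Fin k → Bool, ∏ i, ∏ j, f (M i j) = ((∑ v, f v) ^ n) ^ m := by
  rw [← Fintype.prod_sum (fun (_ : Fin m) (A : Fin n → Fin k → Bool) => ∏ j, f (A j)),
    ← Fintype.prod_sum (fun (_ : Fin n) (v : Fin k → Bool) => f v)]
  simp

theorem sum_lineWeight (k : ℕ) (p : ℝ) :
    ∑ v : Fin k → Bool, ∏ c, (if v c = true then p else 1 - p) = 1 := by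
  rw [← Fintype.prod_sum (fun (_ : Fin k) (b : Bool) => if b = true then p else 1 - p)]
  simp

theorem sum_lineWeight_ne_zero (k : ℕ) (p : ℝ) :
    ∑ v : Fin k → Bool, (if ∀ c, v c = false then 0 else
      ∏ c, (if v c = true then p else 1 - p)) = 1 - (1 - p) ^ k := by
  have h : (1 - p) ^ k = ∑ v : Fin k → Bool, (if ∀ c, v c = false then
      ∏ c, (if v c = true then p else 1 - p) else 0) := by
    rw [Finset.sum_eq_single (fun _ => false)]
    · simp
    · intro v _ hv
      rw [if_neg]
      exact fun h => hv (funext h)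
    · simp
  rw [eq_sub_iff_add_eq, h, ← Finset.sum_add_distrib]
  refine Eq.trans ?_ (sum_lineWeight k p)
  refine Finset.sum_congr rfl fun v _ => ?_
  split_ifs <;> simp

theorem arrProb_true (m n k : ℕ) (p : ℝ) : arrProb m n k p (fun _ => True) = 1 := by
  simp only [arrProb, if_true]
  rw [sum_prod_lines m n k (fun v => ∏ c, (if v c = true then p else 1 - p)), sum_lineWeight]
  simp

theorem arrProb_add_arrProb_not (m n k : ℕ) (p : ℝ)
    (P : (Fin m → Fin n → Fin k → Bool) → Prop) :
    arrProb m n k p P + arrProb m n k p (fun M => ¬ P M) = 1 := by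
  rw [← arrProb_true m n k p]
  simp only [arrProb]
  rw [← Finset.sum_add_distrib]
  refine Finset.sum_congr rfl fun M _ => ?_
  by_cases h : P M <;> simp [h]

theorem arrayWeight_nonneg {m n k : ℕ} {p : ℝ} (h0 : 0 ≤ p) (h1 : p ≤ 1)
    (M : Fin m → Fin n → Fin k → Bool) :
    0 ≤ ∏ i, ∏ j, ∏ c, (if M i j c = true then p else 1 - p) := by
  refine Finset.prod_nonneg fun i _ => Finset.prod_nonneg fun j _ =>
    Finset.prod_nonneg fun c _ => ?_
  split_ifs <;> linarith

theorem arrProb_nonneg {m n k : ℕ} {p : ℝ} (h0 : 0 ≤ p) (h1 : p ≤ 1)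
    (P : (Fin m → Fin n → Fin k → Bool) → Prop) : 0 ≤ arrProb m n k p P := by
  refine Finset.sum_nonneg fun M _ => ?_
  split_ifs
  · exact arrayWeight_nonneg h0 h1 M
  · exact le_rfl

theorem arrProb_mono {m n k : ℕ} {p : ℝ} (h0 : 0 ≤ p) (h1 : p ≤ 1)
    {P Q : (Fin m → Fin n → Fin k → Bool) → Prop} (h : ∀ M, P M → Q M) :
    arrProb m n k p P ≤ arrProb m n k p Q := by
  refine Finset.sum_le_sum fun M _ => ?_
  have := arrayWeight_nonneg h0 h1 M
  by_cases hP : P M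
  · rw [if_pos hP, if_pos (h M hP)]
  · rw [if_neg hP]
    split_ifs
    · exact this
    · exact le_rfl

theorem arrProb_no_zero_line (m n k : ℕ) (p : ℝ) :
    arrProb m n k p (fun M => ¬ ∃ i j, ∀ c, M i j c = false) =
      ((1 - (1 - p) ^ k) ^ n) ^ m := by
  rw [← sum_lineWeight_ne_zero, ← sum_prod_lines, arrProb]
  refine Finset.sum_congr rfl fun M _ => ?_
  by_cases h : ∃ i j, ∀ c, M i j c = false
  · rw [if_neg (not_not.mpr h)]
    obtain ⟨i, j, hij⟩ := h
    symm
    refine Finset.prod_eq_zero (Finset.mem_univ i) (Finset.prod_eq_zero (Finset.mem_univ j) ?_)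
    rw [if_pos hij]
  · rw [if_pos h]
    refine Finset.prod_congr rfl fun i _ => Finset.prod_congr rfl fun j _ => ?_
    rw [if_neg]
    exact fun hij => h ⟨i, j, hij⟩

theorem numOnes_eq_sum {m n k : ℕ} (L : Fin m → Fin n → Fin k → Bool) :
    numOnes L = ∑ i, ∑ j, (Finset.univ.filter (fun c => L i j c = true)).card := by
  simp only [numOnes, Finset.card_filter, Fintype.sum_prod_type]

theorem ContainsLatinBox.no_zero_line {m n k : ℕ} {M : Fin m → Fin n → Fin k → Bool}
    (hM : ContainsLatinBox M) : ¬ ∃ i j, ∀ c, M i j c = false := by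
  rintro ⟨i, j, hij⟩
  obtain ⟨L, ⟨hcard, hline, -, -⟩, hLM⟩ := hM
  have hzero : (Finset.univ.filter (fun c => L i j c = true)).card = 0 := by
    rw [Finset.card_eq_zero, Finset.filter_eq_empty_iff]
    intro c _ hc
    have := hLM i j c hc
    rw [hij c] at this
    exact Bool.false_ne_true this
  have hlt : numOnes L < ∑ _i : Fin m, ∑ _j : Fin n, 1 := by
    rw [numOnes_eq_sum]
    refine Finset.sum_lt_sum (fun i _ => Finset.sum_le_sum fun j _ => hline i j)
      ⟨i, Finset.mem_univ i, ?_⟩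
    exact Finset.sum_lt_sum (fun j _ => hline i j) ⟨j, Finset.mem_univ j, by omega⟩
  simp [hcard] at hlt

theorem inv_le_one_sub_pow {n : ℕ} (hn : 1 ≤ n) {p : ℝ} (hp : p ≤ Real.log n / (2 * n))
    (hp0 : 0 ≤ p) : p ≤ 1 / 2 ∧ (n : ℝ)⁻¹ ≤ (1 - p) ^ n := by
  have hn0 : (0 : ℝ) < n := by exact_mod_cast hn
  have hpn : 2 * (n * p) ≤ Real.log n := by
    rw [le_div_iff₀ (by positivity)] at hp
    linarith
  have hhalf : p ≤ 1 / 2 := by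
    have := Real.log_le_sub_one_of_pos hn0
    by_contra! h
    nlinarith
  refine ⟨hhalf, ?_⟩
  have hexp : Real.exp (-(2 * p)) ≤ 1 - p := by
    rw [Real.exp_neg]
    refine inv_le_of_inv_le₀ (by linarith) ?_
    have h1 : (1 - p)⁻¹ ≤ 2 * p + 1 := by
      rw [inv_le_iff_one_le_mul₀ (by linarith)]
      nlinarith
    exact h1.trans (Real.add_one_le_exp _)
  calc (n : ℝ)⁻¹ = Real.exp (-Real.log n) := by rw [Real.exp_neg, Real.exp_log hn0]
    _ ≤ Real.exp (n * -(2 * p)) := Real.exp_le_exp.mpr (by linarith)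
    _ = Real.exp (-(2 * p)) ^ n := Real.exp_nat_mul _ _
    _ ≤ (1 - p) ^ n := pow_le_pow_left₀ (Real.exp_pos _).le hexp n

theorem arrProb_no_zero_line_le {m n : ℕ} (hn : 1 ≤ n) {p : ℝ}
    (hp : p ≤ Real.log n / (2 * n)) (hp0 : 0 ≤ p) :
    arrProb m n n p (fun M => ¬ ∃ i j, ∀ c, M i j c = false) ≤ Real.exp (-1) ^ m := by
  obtain ⟨hhalf, hpow⟩ := inv_le_one_sub_pow hn hp hp0
  have hn0 : (0 : ℝ) < n := by exact_mod_cast hn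
  have hle1 : (1 - p) ^ n ≤ 1 := pow_le_one₀ (by linarith) (by linarith)
  rw [arrProb_no_zero_line]
  refine pow_le_pow_left₀ (pow_nonneg (by linarith) n) ?_ m
  calc (1 - (1 - p) ^ n) ^ n ≤ Real.exp (-(n : ℝ)⁻¹) ^ n :=
        pow_le_pow_left₀ (by linarith)
          (by have := Real.add_one_le_exp (-(n : ℝ)⁻¹); linarith) n
    _ = Real.exp (-1) := by
        rw [← Real.exp_nat_mul, mul_neg, mul_inv_cancel₀ hn0.ne']

/-- For `ε ∈ (0,1)`, `m = ⌊(1−ε)n⌋` and `p(n) ≤ log n / (2n)`, w.h.p.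
`M ~ M(m,n,n;p)` has an all-zero line `M(i,j,·)`; consequently w.h.p. `M` does not
contain a Latin box. -/
theorem stmt5 (ε : ℝ) (hε : ε ∈ Set.Ioo (0 : ℝ) 1) (p : ℕ → ℝ)
    (hp0 : ∀ n, 0 ≤ p n) (hple : ∀ n : ℕ, p n ≤ Real.log n / (2 * n)) :
    Filter.Tendsto (fun n : ℕ =>
        arrProb ⌊(1 - ε) * (n : ℝ)⌋₊ n n (p n)
          (fun M => ∃ i j, ∀ c, M i j c = false))
      Filter.atTop (nhds 1) ∧
    Filter.Tendsto (fun n : ℕ =>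
        arrProb ⌊(1 - ε) * (n : ℝ)⌋₊ n n (p n) ContainsLatinBox)
      Filter.atTop (nhds 0) := by
  have hm : Filter.Tendsto (fun n : ℕ => ⌊(1 - ε) * (n : ℝ)⌋₊) Filter.atTop Filter.atTop :=
    tendsto_nat_floor_atTop.comp
      (tendsto_natCast_atTop_atTop.const_mul_atTop (by linarith [hε.2]))
  have hexp : Filter.Tendsto (fun n : ℕ => Real.exp (-1) ^ ⌊(1 - ε) * (n : ℝ)⌋₊)
      Filter.atTop (nhds 0) :=
    (tendsto_pow_atTop_nhds_zero_of_lt_one (Real.exp_pos _).le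
      (Real.exp_lt_one_iff.mpr (by norm_num))).comp hm
  have hp1 : ∀ n : ℕ, 1 ≤ n → p n ≤ 1 := fun n hn => by
    linarith [(inv_le_one_sub_pow hn (hple n) (hp0 n)).1]
  have hno : Filter.Tendsto (fun n : ℕ => arrProb ⌊(1 - ε) * (n : ℝ)⌋₊ n n (p n)
      (fun M => ¬ ∃ i j, ∀ c, M i j c = false)) Filter.atTop (nhds 0) := by
    refine squeeze_zero' ?_ ?_ hexp
    · filter_upwards [Filter.eventually_ge_atTop 1] with n hn
      exact arrProb_nonneg (hp0 n) (hp1 n hn) _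
    · filter_upwards [Filter.eventually_ge_atTop 1] with n hn
      exact arrProb_no_zero_line_le hn (hple n) (hp0 n)
  constructor
  · have h := hno.const_sub 1
    rw [sub_zero] at h
    refine h.congr fun n => ?_
    rw [sub_eq_iff_eq_add, arrProb_add_arrProb_not]
  · refine squeeze_zero' ?_ ?_ hno
    · filter_upwards [Filter.eventually_ge_atTop 1] with n hn
      exact arrProb_nonneg (hp0 n) (hp1 n hn) _
    · filter_upwards [Filter.eventually_ge_atTop 1] with n hn
      exact arrProb_mono (hp0 n) (hp1 n hn) fun M hM => hM.no_zero_line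

end
end
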